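/- Under the standing assumptions (Θ nonempty convex with K < ∞, C closed convex containing 0, C∩C^0 compact), let g(y) := inf_{θ∈Θ} g^θ(y) and let ŷ be a maximizer of g over C∩C^0. Then sup_{y∈C∩C^0} g(y) = lim_{n→∞} sup_{y∈C∩C^0_n} g(y) = lim_{n→∞} g((1−1/n)·ŷ). -/

import Mathlib

open MeasureTheory Filter Set
open scoped ENNReal NNReal Topology

noncomputable section

/-- The positive part of an extended real number, as an element of `ℝ≥0∞`. -/
def EReal.posPart (x : EReal) : ℝ≥0∞ := if x = ⊤ then ⊤ else ENNReal.ofReal x.toReal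

/-- Integral of an `EReal`-valued function, defined as the difference of the lintegrals of
the positive and negative parts, with the conventions of `EReal` arithmetic
(in particular `∞ - ∞ = -∞`). -/
def eIntegral {α : Type*} [MeasurableSpace α] (F : Measure α) (f : α → EReal) : EReal :=
  ((∫⁻ z, (f z).posPart ∂F : ℝ≥0∞) : EReal) - ((∫⁻ z, (-(f z)).posPart ∂F : ℝ≥0∞) : EReal)

/-- The dot product `y^⊤ z` on `ℝ^d`. -/
def dotp {d : ℕ} (y z : EuclideanSpace ℝ (Fin d)) : ℝ := ∑ i, y i * z i

/-- The quadratic form `y^⊤ c y`. -/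
def quadf {d : ℕ} (c : Matrix (Fin d) (Fin d) ℝ) (y : EuclideanSpace ℝ (Fin d)) : ℝ :=
  ∑ i, ∑ j, c i j * y i * y j

/-- The (Frobenius) norm `|c|` of a matrix. -/
def matNorm {d : ℕ} (c : Matrix (Fin d) (Fin d) ℝ) : ℝ :=
  Real.sqrt (∑ i, ∑ j, (c i j) ^ 2)

/-- A Lévy measure on `ℝ^d`: a (Borel) measure with `F({0}) = 0` and `∫ |z|² ∧ 1 F(dz) < ∞`. -/
def IsLevyMeasure {d : ℕ} (F : Measure (EuclideanSpace ℝ (Fin d))) : Prop :=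
  F {0} = 0 ∧ ∫⁻ z, ENNReal.ofReal (min (‖z‖ ^ 2) 1) ∂F < ⊤

/-- A truncation function: bounded, measurable, equal to the identity near the origin. -/
structure IsTruncation {d : ℕ}
    (h : EuclideanSpace ℝ (Fin d) → EuclideanSpace ℝ (Fin d)) : Prop where
  measurable : Measurable h
  bounded : ∃ M : ℝ, ∀ z, ‖h z‖ ≤ M
  eq_id_near_zero : ∃ δ : ℝ, 0 < δ ∧ ∀ z, ‖z‖ < δ → h z = z

/-- The integrand `I_y(z)`, as an extended real number:
`log(1+y^⊤z) - y^⊤h(z)` if `p = 0`, and `p⁻¹(1+y^⊤z)^p - p⁻¹ - y^⊤h(z)` if `p ≠ 0`,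
with the conventions `log 0 = -∞` and `0^p = +∞` for `p < 0` (so that the integrand
is `-∞` on `{1 + y^⊤z ≤ 0}` when `p ≤ 0`). -/
def Ifun {d : ℕ} (p : ℝ) (h : EuclideanSpace ℝ (Fin d) → EuclideanSpace ℝ (Fin d))
    (y z : EuclideanSpace ℝ (Fin d)) : EReal :=
  if 0 < 1 + dotp y z then
    (if p = 0 then ((Real.log (1 + dotp y z) - dotp y (h z) : ℝ) : EReal)
      else ((p⁻¹ * (1 + dotp y z) ^ p - p⁻¹ - dotp y (h z) : ℝ) : EReal))
  else if p ≤ 0 then (⊥ : EReal)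
  else ((p⁻¹ * (1 + dotp y z) ^ p - p⁻¹ - dotp y (h z) : ℝ) : EReal)

/-- The function `g^{(b,c,F)}(y) = y^⊤b + ((p-1)/2)·y^⊤cy + ∫ I_y(z) F(dz)`. -/
def gfun {d : ℕ} (p : ℝ) (h : EuclideanSpace ℝ (Fin d) → EuclideanSpace ℝ (Fin d))
    (b : EuclideanSpace ℝ (Fin d)) (c : Matrix (Fin d) (Fin d) ℝ)
    (F : Measure (EuclideanSpace ℝ (Fin d))) (y : EuclideanSpace ℝ (Fin d)) : EReal :=
  ((dotp y b + (p - 1) / 2 * quadf c y : ℝ) : EReal) + eIntegral F (fun z => Ifun p h y z)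

/-- Triples `θ = (b, c, F)`. -/
abbrev Triple (d : ℕ) :=
  EuclideanSpace ℝ (Fin d) × Matrix (Fin d) (Fin d) ℝ × Measure (EuclideanSpace ℝ (Fin d))

/-- `g^θ(y)` for a triple `θ = (b,c,F)`. -/
def gTheta {d : ℕ} (p : ℝ) (h : EuclideanSpace ℝ (Fin d) → EuclideanSpace ℝ (Fin d))
    (θ : Triple d) (y : EuclideanSpace ℝ (Fin d)) : EReal :=
  gfun p h θ.1 θ.2.1 θ.2.2 y

/-- The integrand appearing in the definition of the constant `K`, depending on `p`
(and an extra parameter `ε > 0` when `p ∈ (0,1)`). -/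
def Kintegrand {d : ℕ} (p ε : ℝ) (z : EuclideanSpace ℝ (Fin d)) : ℝ :=
  if p = 0 then min (‖z‖ ^ 2) (Real.log (1 + ‖z‖))
  else if 0 < p then min (‖z‖ ^ 2) (‖z‖ ^ (p * (1 + ε)))
  else min (‖z‖ ^ 2) 1

/-- The natural constraints `C⁰ = ∩_{F ∈ L_Θ} {y : F({z : y^⊤z < -1}) = 0}`. -/
def natC {d : ℕ} (Θ : Set (Triple d)) : Set (EuclideanSpace ℝ (Fin d)) :=
  {y | ∀ θ ∈ Θ, θ.2.2 {z | dotp y z < -1} = 0}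

/-- The sets `C⁰ₙ = ∩_{F ∈ L_Θ} {y : F({z : y^⊤z < -1 + 1/n}) = 0}`. -/
def natCn {d : ℕ} (Θ : Set (Triple d)) (n : ℕ) : Set (EuclideanSpace ℝ (Fin d)) :=
  {y | ∀ θ ∈ Θ, θ.2.2 {z | dotp y z < -1 + 1 / (n : ℝ)} = 0}

/-- The finite measure `|z|² ∧ 1 · F`. -/
def sq1Measure {d : ℕ} (F : Measure (EuclideanSpace ℝ (Fin d))) :
    Measure (EuclideanSpace ℝ (Fin d)) :=
  F.withDensity (fun z => ENNReal.ofReal (min (‖z‖ ^ 2) 1))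

/-- The standing assumptions of the paper: `p = 0` or `p ∈ (-∞,0) ∪ (0,1)`, `ε > 0`,
`h` is a truncation function, `Θ` is a nonempty convex set of Lévy triplets with `K < ∞`,
`C` is closed, convex and contains `0`, and `C ∩ C⁰` is compact. -/
structure Standing {d : ℕ} (p ε : ℝ)
    (h : EuclideanSpace ℝ (Fin d) → EuclideanSpace ℝ (Fin d))
    (Θ : Set (Triple d)) (C : Set (EuclideanSpace ℝ (Fin d))) : Prop where
  p_range : p = 0 ∨ p < 0 ∨ (0 < p ∧ p < 1)
  eps_pos : 0 < ε
  trunc : IsTruncation h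
  Theta_nonempty : Θ.Nonempty
  Theta_psd : ∀ θ ∈ Θ, (θ.2.1).PosSemidef
  Theta_levy : ∀ θ ∈ Θ, IsLevyMeasure θ.2.2
  Theta_convex : ∀ θ₁ ∈ Θ, ∀ θ₂ ∈ Θ, ∀ t : ℝ, 0 ≤ t → t ≤ 1 →
    (t • θ₁.1 + (1 - t) • θ₂.1, t • θ₁.2.1 + (1 - t) • θ₂.2.1,
      ENNReal.ofReal t • θ₁.2.2 + ENNReal.ofReal (1 - t) • θ₂.2.2) ∈ Θ
  K_finite : ∃ K : ℝ, ∀ θ ∈ Θ,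
    (∫⁻ z, ENNReal.ofReal (Kintegrand p ε z) ∂θ.2.2) ≠ ⊤ ∧
    ‖θ.1‖ + matNorm θ.2.1 + (∫⁻ z, ENNReal.ofReal (Kintegrand p ε z) ∂θ.2.2).toReal ≤ K
  C_closed : IsClosed C
  C_convex : Convex ℝ C
  C_zero : (0 : EuclideanSpace ℝ (Fin d)) ∈ C
  CC0_compact : IsCompact (C ∩ natC Θ)

lemma dotp_smul {d : ℕ} (t : ℝ) (y z : EuclideanSpace ℝ (Fin d)) :
    dotp (t • y) z = t * dotp y z := by
  simp [dotp, Finset.mul_sum, mul_assoc]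

lemma quadf_smul {d : ℕ} (c : Matrix (Fin d) (Fin d) ℝ) (t : ℝ)
    (y : EuclideanSpace ℝ (Fin d)) : quadf c (t • y) = t ^ 2 * quadf c y := by
  simp only [quadf, Finset.mul_sum, PiLp.smul_apply, smul_eq_mul]
  exact Finset.sum_congr rfl fun i _ => Finset.sum_congr rfl fun j _ => by ring

lemma quadf_nonneg {d : ℕ} {c : Matrix (Fin d) (Fin d) ℝ} (hc : c.PosSemidef)
    (y : EuclideanSpace ℝ (Fin d)) : 0 ≤ quadf c y := by
  have key := hc.dotProduct_mulVec_nonneg (WithLp.ofLp y)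
  simp only [dotProduct, Matrix.mulVec, Finset.mul_sum, star_trivial] at key
  refine key.trans_eq (Finset.sum_congr rfl fun i _ => Finset.sum_congr rfl fun j _ => by ring)

lemma EReal.posPart_eq_toENNReal (x : EReal) : x.posPart = x.toENNReal := rfl

/-- The integral with the convention `∞ - ∞ = -∞` is monotone, without measurability. -/
lemma eIntegral_mono_ae {α : Type*} [MeasurableSpace α] {F : Measure α} {f g : α → EReal}
    (hfg : ∀ᵐ z ∂F, f z ≤ g z) : eIntegral F f ≤ eIntegral F g := by
  refine EReal.sub_le_sub ?_ ?_ <;> rw [EReal.coe_ennreal_le_coe_ennreal_iff] <;>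
    refine lintegral_mono_ae ?_ <;> filter_upwards [hfg] with z hz
  · exact EReal.toENNReal_le_toENNReal hz
  · exact EReal.toENNReal_le_toENNReal (EReal.neg_le_neg_iff.2 hz)

lemma eIntegral_const_mul {α : Type*} [MeasurableSpace α] (F : Measure α) (f : α → EReal)
    {t : ℝ} (ht : 0 ≤ t) : eIntegral F (fun z => (t : EReal) * f z) = t * eIntegral F f := by
  have ht' : (0 : EReal) ≤ t := EReal.coe_nonneg.2 ht
  have ht_coe : ((ENNReal.ofReal t : ℝ≥0∞) : EReal) = t := by
    rw [EReal.coe_ennreal_ofReal, max_eq_left ht]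
  simp only [eIntegral, EReal.posPart_eq_toENNReal, ← mul_neg, EReal.toENNReal_mul ht',
    EReal.toENNReal_of_ne_top (EReal.coe_ne_top t), EReal.toReal_coe]
  rw [lintegral_const_mul' _ _ ENNReal.ofReal_ne_top,
    lintegral_const_mul' _ _ ENNReal.ofReal_ne_top, EReal.coe_ennreal_mul,
    EReal.coe_ennreal_mul, ht_coe, sub_eq_add_neg, sub_eq_add_neg, ← mul_neg,
    EReal.left_distrib_of_nonneg_of_ne_top ht' (EReal.coe_ne_top t)]

lemma mul_log_le_log_segment {t x : ℝ} (ht₀ : 0 ≤ t) (ht₁ : t ≤ 1) (hx : 0 < 1 + x) :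
    t * Real.log (1 + x) ≤ Real.log (1 + t * x) := by
  have key := strictConcaveOn_log_Ioi.concaveOn.2 (mem_Ioi.2 hx) (mem_Ioi.2 one_pos) ht₀
    (sub_nonneg.2 ht₁) (by ring)
  simp only [smul_eq_mul, Real.log_one, mul_zero, add_zero] at key
  rwa [show t * (1 + x) + (1 - t) * 1 = 1 + t * x by ring] at key

lemma mul_rpow_le_rpow_segment_of_pos {p t x : ℝ} (hp₀ : 0 < p) (hp₁ : p ≤ 1) (ht₀ : 0 ≤ t)
    (ht₁ : t ≤ 1) (hx : 0 ≤ 1 + x) :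
    t * (p⁻¹ * (1 + x) ^ p - p⁻¹) ≤ p⁻¹ * (1 + t * x) ^ p - p⁻¹ := by
  have key := (Real.concaveOn_rpow hp₀.le hp₁).2 (mem_Ici.2 hx) (mem_Ici.2 zero_le_one) ht₀
    (sub_nonneg.2 ht₁) (by ring)
  simp only [smul_eq_mul, Real.one_rpow] at key
  rw [show t * (1 + x) + (1 - t) * 1 = 1 + t * x by ring] at key
  nlinarith [mul_le_mul_of_nonneg_left key (inv_nonneg.2 hp₀.le)]

lemma mul_rpow_le_rpow_segment_of_neg {p t x : ℝ} (hp : p < 0) (ht₀ : 0 ≤ t)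
    (ht₁ : t ≤ 1) (hx : 0 < 1 + x) :
    t * (p⁻¹ * (1 + x) ^ p - p⁻¹) ≤ p⁻¹ * (1 + t * x) ^ p - p⁻¹ := by
  have hpos : 0 < 1 + t * x := by
    rcases ht₀.eq_or_lt with rfl | ht
    · simp
    · linarith [mul_pos ht hx]
  have hexp := convexOn_exp.2 (mem_univ (Real.log (1 + x) * p)) (mem_univ 0) ht₀
    (sub_nonneg.2 ht₁) (by ring)
  simp only [smul_eq_mul, mul_zero, add_zero, Real.exp_zero, mul_one,
    ← Real.rpow_def_of_pos hx] at hexp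
  have hlog := mul_le_mul_of_nonpos_right (mul_log_le_log_segment ht₀ ht₁ hx) hp.le
  have key : (1 + t * x) ^ p ≤ t * (1 + x) ^ p + (1 - t) := by
    rw [Real.rpow_def_of_pos hpos]
    exact (Real.exp_le_exp.2 (by linarith)).trans hexp
  nlinarith [mul_le_mul_of_nonpos_left key (inv_nonpos.2 hp.le)]

lemma mul_Ifun_le_Ifun_smul {d : ℕ} {p : ℝ} (hp : p ≤ 1)
    (h : EuclideanSpace ℝ (Fin d) → EuclideanSpace ℝ (Fin d))
    (y z : EuclideanSpace ℝ (Fin d)) {t : ℝ} (ht₀ : 0 < t) (ht₁ : t < 1)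
    (hyz : 0 ≤ 1 + dotp y z) : (t : EReal) * Ifun p h y z ≤ Ifun p h (t • y) z := by
  have hpos : 0 < 1 + t * dotp y z := by nlinarith
  unfold Ifun
  simp only [dotp_smul, if_pos hpos]
  split_ifs with h1 h2 h3 h3 <;> try rw [← EReal.coe_mul, EReal.coe_le_coe_iff]
  · linarith [mul_log_le_log_segment ht₀.le ht₁.le h1]
  · rcases lt_or_gt_of_ne h2 with hp0 | hp0
    · linarith [mul_rpow_le_rpow_segment_of_neg hp0 ht₀.le ht₁.le h1]
    · linarith [mul_rpow_le_rpow_segment_of_pos hp0 hp ht₀.le ht₁.le h1.le]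
  · simp [EReal.coe_mul_bot_of_pos ht₀]
  · simp [EReal.coe_mul_bot_of_pos ht₀]
  · linarith
  · linarith [mul_rpow_le_rpow_segment_of_pos (not_le.1 h3) hp ht₀.le ht₁.le hyz]

lemma mul_gfun_le_gfun_smul {d : ℕ} {p : ℝ} (hp : p ≤ 1)
    (h : EuclideanSpace ℝ (Fin d) → EuclideanSpace ℝ (Fin d))
    (b : EuclideanSpace ℝ (Fin d)) {c : Matrix (Fin d) (Fin d) ℝ} (hc : c.PosSemidef)
    {F : Measure (EuclideanSpace ℝ (Fin d))} {y : EuclideanSpace ℝ (Fin d)}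
    (hy : F {z | dotp y z < -1} = 0) {t : ℝ} (ht₀ : 0 < t) (ht₁ : t < 1) :
    (t : EReal) * gfun p h b c F y ≤ gfun p h b c F (t • y) := by
  unfold gfun
  rw [EReal.left_distrib_of_nonneg_of_ne_top (EReal.coe_nonneg.2 ht₀.le) (EReal.coe_ne_top t),
    ← eIntegral_const_mul F _ ht₀.le]
  refine add_le_add ?_ (eIntegral_mono_ae ?_)
  · rw [← EReal.coe_mul, EReal.coe_le_coe_iff, dotp_smul, quadf_smul]
    have := mul_nonneg (mul_nonneg (mul_nonneg ht₀.le (sub_nonneg.2 ht₁.le))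
      (sub_nonneg.2 hp)) (quadf_nonneg hc y)
    nlinarith
  · have hae : ∀ᵐ z ∂F, ¬ dotp y z < -1 := measure_eq_zero_iff_ae_notMem.1 hy
    filter_upwards [hae] with z hz
    exact mul_Ifun_le_Ifun_smul hp h y z ht₀ ht₁ (by linarith [not_lt.1 hz])

lemma natCn_subset_natC {d : ℕ} (Θ : Set (Triple d)) (n : ℕ) : natCn Θ n ⊆ natC Θ := by
  intro y hy θ hθ
  refine measure_mono_null (fun z hz => ?_) (hy θ hθ)
  have : (0 : ℝ) ≤ 1 / (n : ℝ) := by positivity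
  have hz' : dotp y z < -1 := hz
  change dotp y z < -1 + 1 / (n : ℝ)
  linarith

lemma smul_mem_natCn {d : ℕ} {Θ : Set (Triple d)} {y : EuclideanSpace ℝ (Fin d)}
    (hy : y ∈ natC Θ) {n : ℕ} (hn : 0 < 1 - 1 / (n : ℝ)) :
    (1 - 1 / (n : ℝ)) • y ∈ natCn Θ n := by
  intro θ hθ
  refine measure_mono_null (fun z hz => ?_) (hy θ hθ)
  have hz' : dotp ((1 - 1 / (n : ℝ)) • y) z < -1 + 1 / (n : ℝ) := hz
  rw [dotp_smul] at hz'
  change dotp y z < -1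
  by_contra hcon
  nlinarith [mul_le_mul_of_nonneg_left (not_lt.1 hcon) hn.le]

/-- Under the standing assumptions, if `yhat` maximizes
`g(y) = inf_{θ ∈ Θ} g^θ(y)` over `C ∩ C⁰`, then `sup_{y ∈ C ∩ C⁰} g(y)
 = lim_n sup_{y ∈ C ∩ C⁰ₙ} g(y) = lim_n g((1 - 1/n)·yhat)`. -/
theorem stmt7 {d : ℕ} (hd : 1 ≤ d) (p ε : ℝ)
    (h : EuclideanSpace ℝ (Fin d) → EuclideanSpace ℝ (Fin d))
    (Θ : Set (Triple d)) (C : Set (EuclideanSpace ℝ (Fin d)))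
    (SA : Standing p ε h Θ C)
    (yhat : EuclideanSpace ℝ (Fin d)) (hyhat : yhat ∈ C ∩ natC Θ)
    (hmax : ∀ y ∈ C ∩ natC Θ,
      (⨅ θ ∈ Θ, gTheta p h θ y) ≤ ⨅ θ ∈ Θ, gTheta p h θ yhat) :
    Tendsto (fun n : ℕ => ⨆ y ∈ C ∩ natCn Θ n, ⨅ θ ∈ Θ, gTheta p h θ y) atTop
      (nhds (⨆ y ∈ C ∩ natC Θ, ⨅ θ ∈ Θ, gTheta p h θ y)) ∧
    Tendsto (fun n : ℕ => ⨅ θ ∈ Θ, gTheta p h θ ((1 - 1 / (n : ℝ)) • yhat)) atTop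
      (nhds (⨆ y ∈ C ∩ natC Θ, ⨅ θ ∈ Θ, gTheta p h θ y)) := by
  have hp : p ≤ 1 := by rcases SA.p_range with hp | hp | hp <;> linarith
  set g : EuclideanSpace ℝ (Fin d) → EReal := fun y => ⨅ θ ∈ Θ, gTheta p h θ y with hg
  have hsup : ⨆ y ∈ C ∩ natC Θ, g y = g yhat :=
    le_antisymm (iSup₂_le hmax) (le_iSup₂ (f := fun y _ => g y) yhat hyhat)
  change Tendsto (fun n : ℕ => ⨆ y ∈ C ∩ natCn Θ n, g y) atTop
      (nhds (⨆ y ∈ C ∩ natC Θ, g y)) ∧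
    Tendsto (fun n : ℕ => g ((1 - 1 / (n : ℝ)) • yhat)) atTop
      (nhds (⨆ y ∈ C ∩ natC Θ, g y))
  rw [hsup]
  have hscale : ∀ t : ℝ, 0 < t → t < 1 → (t : EReal) * g yhat ≤ g (t • yhat) := by
    intro t ht₀ ht₁
    refine le_iInf₂ fun θ hθ => ?_
    refine (mul_le_mul_of_nonneg_left (iInf₂_le θ hθ) (EReal.coe_nonneg.2 ht₀.le)).trans ?_
    exact mul_gfun_le_gfun_smul hp h θ.1 (SA.Theta_psd θ hθ) (hyhat.2 θ hθ) ht₀ ht₁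
  have hmem : ∀ n : ℕ, 2 ≤ n → (1 - 1 / (n : ℝ)) • yhat ∈ C ∩ natCn Θ n ∧
      0 < 1 - 1 / (n : ℝ) ∧ 1 - 1 / (n : ℝ) < 1 := by
    intro n hn
    have hn' : (2 : ℝ) ≤ n := by exact_mod_cast hn
    have hinv : 0 < 1 / (n : ℝ) := by positivity
    have hinv' : 1 / (n : ℝ) ≤ 1 / 2 := one_div_le_one_div_of_le two_pos hn'
    have h0 : 0 < 1 - 1 / (n : ℝ) := by linarith
    have h1 : 1 - 1 / (n : ℝ) < 1 := by linarith
    exact ⟨⟨SA.C_convex.smul_mem_of_zero_mem SA.C_zero hyhat.1 ⟨h0.le, h1.le⟩,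
      smul_mem_natCn hyhat.2 h0⟩, h0, h1⟩
  have hlower : Tendsto (fun n : ℕ => ((1 - 1 / (n : ℝ) : ℝ) : EReal) * g yhat) atTop
      (nhds (g yhat)) := by
    have hreal : Tendsto (fun n : ℕ => 1 - 1 / (n : ℝ)) atTop (nhds 1) := by
      simpa using tendsto_const_nhds.sub (tendsto_one_div_atTop_nhds_zero_nat (𝕜 := ℝ))
    have hcoe : Tendsto (fun n : ℕ => ((1 - 1 / (n : ℝ) : ℝ) : EReal)) atTop
        (nhds ((1 : ℝ) : EReal)) := (continuous_coe_real_ereal.tendsto 1).comp hreal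
    have hmul := (EReal.continuousAt_mul (p := (((1 : ℝ) : EReal), g yhat))
      (Or.inl (by simp)) (Or.inl (by simp)) (Or.inl (EReal.coe_ne_bot 1))
      (Or.inl (EReal.coe_ne_top 1))).tendsto.comp (hcoe.prodMk_nhds tendsto_const_nhds)
    simpa [Function.comp_def] using hmul
  constructor
  · refine tendsto_of_tendsto_of_tendsto_of_le_of_le' hlower tendsto_const_nhds ?_
      (Eventually.of_forall fun n =>
        iSup₂_le fun y hy => hmax y ⟨hy.1, natCn_subset_natC Θ n hy.2⟩)
    filter_upwards [eventually_ge_atTop 2] with n hn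
    obtain ⟨hC, h0, h1⟩ := hmem n hn
    exact (hscale _ h0 h1).trans (le_iSup₂ (f := fun y _ => g y) _ hC)
  · refine tendsto_of_tendsto_of_tendsto_of_le_of_le' hlower tendsto_const_nhds ?_ ?_ <;>
      filter_upwards [eventually_ge_atTop 2] with n hn <;> obtain ⟨hC, h0, h1⟩ := hmem n hn
    · exact hscale _ h0 h1
    · exact hmax _ ⟨hC.1, natCn_subset_natC Θ n hC.2⟩
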